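/- arXiv:2506.17145 — 2 statements merged into one kernel-verified Lean document; each statement's English description precedes it below -/
import Mathlib

section
/- Let f be convex and L-smooth on a real inner product space, assume f attains a global minimum at x*, let h ∈ [0, 2], and let x1 = x0 - (h/L)∇f(x0) be one exact gradient step from x0. Then (1/L)·‖∇f(x1)‖² ≤ max{ 1/(h + 1/2) , 2(1-h)² } · (f(x0) - f(x*)). -/
theorem aux_line {H : Type*} [NormedAddCommGroup H] [InnerProductSpace ℝ H] [CompleteSpace H]
    (f : H → ℝ) (f' : H → H) (hgrad : ∀ x, HasGradientAt f (f' x) x) (x d : H) (t : ℝ) :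
    HasDerivAt (fun t : ℝ => f (x + t • d)) (inner ℝ (f' (x + t • d)) d) t := by
  have h1 : HasDerivAt (fun t : ℝ => x + t • d) d t := by
    simpa using ((hasDerivAt_id t).smul_const d).const_add x
  have h2 := (hgrad (x + t • d)).hasFDerivAt.comp_hasDerivAt t h1
  simpa [Function.comp_def] using h2

theorem aux_conv {H : Type*} [NormedAddCommGroup H] [InnerProductSpace ℝ H] [CompleteSpace H]
    (f : H → ℝ) (f' : H → H) (hconv : ConvexOn ℝ Set.univ f)
    (hgrad : ∀ x, HasGradientAt f (f' x) x) (x d : H) :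
    f x + inner ℝ (f' x) d ≤ f (x + d) := by
  have hc : ConvexOn ℝ Set.univ (fun t : ℝ => f (x + t • d)) := by
    refine ⟨convex_univ, fun s _ t _ a b ha hb hab => ?_⟩
    have := hconv.2 (Set.mem_univ (x + s • d)) (Set.mem_univ (x + t • d)) ha hb hab
    convert this using 2
    have hx : x = a • x + b • x := by rw [← add_smul, hab, one_smul]
    nth_rewrite 1 [hx]
    simp only [smul_add, add_smul, smul_smul, smul_eq_mul]
    abel
  have h0 := aux_line f f' hgrad x d 0
  have := hc.le_slope_of_hasDerivAt (Set.mem_univ 0) (Set.mem_univ 1) one_pos h0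
  simp [slope_def_field] at this
  linarith

theorem aux_descent {H : Type*} [NormedAddCommGroup H] [InnerProductSpace ℝ H] [CompleteSpace H]
    (f : H → ℝ) (f' : H → H) (L : ℝ) (hL : 0 < L)
    (hgrad : ∀ x, HasGradientAt f (f' x) x)
    (hlip : LipschitzWith L.toNNReal f') (x d : H) :
    f (x + d) ≤ f x + inner ℝ (f' x) d + L / 2 * ‖d‖ ^ 2 := by
  let φ : ℝ → ℝ := fun t => f (x + t • d) - t * inner ℝ (f' x) d - L / 2 * ‖d‖ ^ 2 * t ^ 2
  have hd : ∀ t, HasDerivAt φ (inner ℝ (f' (x + t • d)) d - inner ℝ (f' x) d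
      - L / 2 * ‖d‖ ^ 2 * (2 * t)) t := by
    intro t
    have h2 : HasDerivAt (fun t : ℝ => t * inner ℝ (f' x) d) (inner ℝ (f' x) d) t := by
      simpa using (hasDerivAt_id t).mul_const (inner ℝ (f' x) d)
    have h3 : HasDerivAt (fun t : ℝ => L / 2 * ‖d‖ ^ 2 * t ^ 2)
        (L / 2 * ‖d‖ ^ 2 * (2 * t)) t := by
      simpa using (hasDerivAt_pow 2 t).const_mul (L / 2 * ‖d‖ ^ 2)
    exact ((aux_line f f' hgrad x d t).sub h2).sub h3
  have hanti : AntitoneOn φ (Set.Icc 0 1) := by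
    apply antitoneOn_of_deriv_nonpos (convex_Icc 0 1)
    · exact fun t _ => (hd t).continuousAt.continuousWithinAt
    · exact fun t _ => (hd t).differentiableAt.differentiableWithinAt
    · intro t ht
      rw [interior_Icc] at ht
      rw [(hd t).deriv, ← inner_sub_left]
      have h1 := real_inner_le_norm (f' (x + t • d) - f' x) d
      have h2 := hlip.norm_sub_le (x + t • d) x
      rw [Real.coe_toNNReal L hL.le, add_sub_cancel_left, norm_smul, Real.norm_eq_abs,
        abs_of_pos ht.1] at h2
      nlinarith [mul_le_mul_of_nonneg_right h2 (norm_nonneg d)]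
  have := hanti (Set.left_mem_Icc.2 zero_le_one) (Set.right_mem_Icc.2 zero_le_one) zero_le_one
  simp [φ] at this
  linarith

theorem aux_interp {H : Type*} [NormedAddCommGroup H] [InnerProductSpace ℝ H] [CompleteSpace H]
    (f : H → ℝ) (f' : H → H) (L : ℝ) (hL : 0 < L)
    (hconv : ConvexOn ℝ Set.univ f)
    (hgrad : ∀ x, HasGradientAt f (f' x) x)
    (hlip : LipschitzWith L.toNNReal f') (x y : H) :
    f x + inner ℝ (f' x) (y - x) + 1 / (2 * L) * ‖f' x - f' y‖ ^ 2 ≤ f y := by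
  have h1 := aux_descent f f' L hL hgrad hlip y ((1 / L) • (f' x - f' y))
  have h2 := aux_conv f f' hconv hgrad x (y - x + (1 / L) • (f' x - f' y))
  rw [show x + (y - x + (1 / L) • (f' x - f' y)) = y + (1 / L) • (f' x - f' y) by abel] at h2
  rw [norm_smul, mul_pow, Real.norm_eq_abs, sq_abs, inner_smul_right] at h1
  rw [inner_add_right, inner_smul_right] at h2
  have h3 : ‖f' x - f' y‖ ^ 2 = inner ℝ (f' x) (f' x - f' y) - inner ℝ (f' y) (f' x - f' y) := by
    rw [← inner_sub_left, real_inner_self_eq_norm_sq]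
  have h4 : L / 2 * ((1 / L) ^ 2 * ‖f' x - f' y‖ ^ 2) = 1 / (2 * L) * ‖f' x - f' y‖ ^ 2 := by
    field_simp
  have h5 : 1 / L * ‖f' x - f' y‖ ^ 2 = 1 / L * inner ℝ (f' x) (f' x - f' y)
      - 1 / L * inner ℝ (f' y) (f' x - f' y) := by rw [h3]; ring
  have h6 : 1 / L * ‖f' x - f' y‖ ^ 2 = 2 * (1 / (2 * L) * ‖f' x - f' y‖ ^ 2) := by
    field_simp
  linarith

theorem aux_min {H : Type*} [NormedAddCommGroup H] [InnerProductSpace ℝ H] [CompleteSpace H]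
    (f : H → ℝ) (f' : H → H) (L : ℝ) (hL : 0 < L)
    (hgrad : ∀ x, HasGradientAt f (f' x) x)
    (hlip : LipschitzWith L.toNNReal f') (xstar : H) (hmin : ∀ y, f xstar ≤ f y) (x : H) :
    1 / (2 * L) * ‖f' x‖ ^ 2 ≤ f x - f xstar := by
  have h1 := aux_descent f f' L hL hgrad hlip x (-(1 / L) • f' x)
  have h2 := hmin (x + -(1 / L) • f' x)
  rw [norm_smul, mul_pow, Real.norm_eq_abs, sq_abs, inner_smul_right,
    real_inner_self_eq_norm_sq] at h1
  have h4 : -(1 / L) * ‖f' x‖ ^ 2 + L / 2 * ((-(1 / L)) ^ 2 * ‖f' x‖ ^ 2)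
      = - (1 / (2 * L) * ‖f' x‖ ^ 2) := by
    field_simp
    ring
  linarith


/-- One step of exact gradient descent on a convex `L`-smooth function
attaining its minimum at `xstar`, with normalized stepsize `h ∈ [0, 2]`:
`(1/L)·‖∇f(x1)‖² ≤ max { 1/(h + 1/2) , 2(1-h)² } · (f(x0) - f(x*))`. -/
theorem one_step_exact_gd_initial_gap
    {H : Type*} [NormedAddCommGroup H] [InnerProductSpace ℝ H] [CompleteSpace H]
    (f : H → ℝ) (f' : H → H) (L : ℝ) (hL : 0 < L)
    (hconv : ConvexOn ℝ Set.univ f)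
    (hgrad : ∀ x, HasGradientAt f (f' x) x)
    (hlip : LipschitzWith L.toNNReal f')
    (xstar : H) (hmin : ∀ y, f xstar ≤ f y)
    (h : ℝ) (hh : h ∈ Set.Icc (0 : ℝ) 2)
    (x0 x1 : H) (hx1 : x1 = x0 - (h / L) • f' x0) :
    (1 / L) * ‖f' x1‖ ^ 2 ≤
      max (1 / (h + 1 / 2)) (2 * (1 - h) ^ 2) * (f x0 - f xstar) := by
  obtain ⟨hh0, hh2⟩ := hh
  have hA := aux_interp f f' L hL hconv hgrad hlip x1 x0
  have hB := aux_interp f f' L hL hconv hgrad hlip x0 x1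
  have hC := aux_min f f' L hL hgrad hlip xstar hmin x1
  have hD := aux_min f f' L hL hgrad hlip xstar hmin x0
  have e1 : x0 - x1 = (h / L) • f' x0 := by rw [hx1]; abel
  have e2 : x1 - x0 = -((h / L) • f' x0) := by rw [hx1]; abel
  rw [e1, inner_smul_right, norm_sub_sq_real] at hA
  rw [e2, inner_neg_right, inner_smul_right, norm_sub_sq_real, real_inner_self_eq_norm_sq] at hB
  rw [real_inner_comm] at hA
  have hE : 0 ≤ f x0 - f xstar := sub_nonneg.2 (hmin x0)
  have hK : 0 ≤ 1 / L * ‖f' x0 - f' x1‖ ^ 2 := by positivity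
  rw [norm_sub_sq_real] at hK
  rw [show 1 / (2 * L) = (1 / L) / 2 by field_simp] at hA hB hC hD
  rw [show h / L = h * (1 / L) by ring] at hA hB
  clear e1 e2 hx1
  generalize hp : inner ℝ (f' x0) (f' x1) = p at *
  generalize ‖f' x0‖ ^ 2 = a at *
  generalize ‖f' x1‖ ^ 2 = b at *
  generalize 1 / L = l at *
  by_cases hc : h ≤ 3 / 2
  · refine le_trans ?_ (mul_le_mul_of_nonneg_right (le_max_left _ _) hE)
    rw [one_div_mul_eq_div, le_div_iff₀ (by linarith)]
    nlinarith [mul_nonneg (sub_nonneg.2 hc) hK]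
  · refine le_trans ?_ (mul_le_mul_of_nonneg_right (le_max_right _ _) hE)
    obtain ⟨s, rfl⟩ : ∃ s, h = 1 + s := ⟨h - 1, by ring⟩
    have hs : 1 / 2 < s := by linarith
    have hs1 : s ≤ 1 := by linarith
    have k1 := mul_le_mul_of_nonneg_left hA (show 0 ≤ (1 - s) + s by linarith)
    have k2 := mul_le_mul_of_nonneg_left hB (show 0 ≤ s by linarith)
    have k3 := mul_le_mul_of_nonneg_left hC (show 0 ≤ 1 - s by linarith)
    have k4 := mul_le_mul_of_nonneg_left hD (show 0 ≤ 2 * s ^ 2 - (1 - s) by nlinarith)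
    nlinarith
end

section
/- Let f be convex and L-smooth on a real inner product space, assume f attains a global minimum at x*, let h ∈ [0, 2] and N ≥ 1, and define iterates by x_{k+1} = x_k - (h/L)∇f(x_k) for k = 0, …, N-1. Then (1/L)·‖∇f(x_N)‖² ≤ max{ 1/(N·h + 1/2) , 2(1-h)^{2N} } · (f(x0) - f(x*)). -/
/-- Descent lemma. -/
theorem gd_descent {H : Type*} [NormedAddCommGroup H] [InnerProductSpace ℝ H] [CompleteSpace H]
    (f : H → ℝ) (f' : H → H) (L : ℝ) (hL : 0 < L)
    (hgrad : ∀ x, HasGradientAt f (f' x) x)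
    (hlip : LipschitzWith L.toNNReal f') (x v : H) :
    f (x + v) ≤ f x + inner ℝ (f' x) v + L / 2 * ‖v‖ ^ 2 := by
  let φ : ℝ → ℝ := fun t => f (x + t • v) - t * inner ℝ (f' x) v - L / 2 * t ^ 2 * ‖v‖ ^ 2
  have hd : ∀ t : ℝ, HasDerivAt φ
      (inner ℝ (f' (x + t • v)) v - inner ℝ (f' x) v - L * t * ‖v‖ ^ 2) t := by
    intro t
    have h1 : HasDerivAt (fun t : ℝ => x + t • v) v t := by
      simpa using ((hasDerivAt_id t).smul_const v).const_add x
    have h2 : HasDerivAt (fun t : ℝ => f (x + t • v)) (inner ℝ (f' (x + t • v)) v) t := by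
      have := (hgrad (x + t • v)).hasFDerivAt.comp_hasDerivAt t h1
      simp only [InnerProductSpace.toDual_apply_apply] at this
      exact this
    have h3 : HasDerivAt (fun t : ℝ => t * inner ℝ (f' x) v) (inner ℝ (f' x) v) t := by
      simpa using (hasDerivAt_id t).mul_const (inner ℝ (f' x) v)
    have h4 : HasDerivAt (fun t : ℝ => L / 2 * t ^ 2 * ‖v‖ ^ 2) (L * t * ‖v‖ ^ 2) t := by
      have := ((hasDerivAt_pow 2 t).const_mul (L / 2)).mul_const (‖v‖ ^ 2)
      refine this.congr_deriv ?_
      push_cast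
      ring
    exact (h2.sub h3).sub h4
  have hanti : AntitoneOn φ (Set.Icc 0 1) := by
    apply antitoneOn_of_deriv_nonpos (convex_Icc 0 1)
    · exact fun t _ => (hd t).continuousAt.continuousWithinAt
    · exact fun t _ => (hd t).differentiableAt.differentiableWithinAt
    · intro t ht
      rw [interior_Icc] at ht
      rw [(hd t).deriv, ← inner_sub_left]
      have h5 := real_inner_le_norm (f' (x + t • v) - f' x) v
      have h6 := hlip.dist_le_mul (x + t • v) x
      rw [dist_eq_norm, dist_eq_norm, Real.coe_toNNReal _ hL.le, add_sub_cancel_left,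
        norm_smul, Real.norm_eq_abs, abs_of_pos ht.1] at h6
      have h7 := mul_le_mul_of_nonneg_right h6 (norm_nonneg v)
      nlinarith
  have := hanti (Set.left_mem_Icc.2 zero_le_one) (Set.right_mem_Icc.2 zero_le_one) zero_le_one
  simp only [φ, one_smul, zero_smul, add_zero] at this
  linarith

/-- First-order convexity. -/
theorem gd_convex {H : Type*} [NormedAddCommGroup H] [InnerProductSpace ℝ H] [CompleteSpace H]
    (f : H → ℝ) (f' : H → H) (hconv : ConvexOn ℝ Set.univ f)
    (hgrad : ∀ x, HasGradientAt f (f' x) x) (y v : H) :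
    f y + inner ℝ (f' y) v ≤ f (y + v) := by
  have h1 : HasDerivAt (fun t : ℝ => y + t • v) v 0 := by
    simpa using ((hasDerivAt_id (0 : ℝ)).smul_const v).const_add y
  have h2 : HasDerivAt (fun t : ℝ => f (y + t • v)) (inner ℝ (f' y) v) 0 := by
    have h0 := (hgrad (y + (0 : ℝ) • v)).hasFDerivAt.comp_hasDerivAt (0 : ℝ) h1
    simp only [InnerProductSpace.toDual_apply_apply, zero_smul, add_zero] at h0
    exact h0
  have hc : ConvexOn ℝ Set.univ (fun t : ℝ => f (y + t • v)) := by
    refine ⟨convex_univ, fun s _ t _ a b ha hb hab => ?_⟩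
    have := hconv.2 (Set.mem_univ (y + s • v)) (Set.mem_univ (y + t • v)) ha hb hab
    convert this using 2
    have hy : y = (a + b) • y := by rw [hab, one_smul]
    nth_rewrite 1 [hy]
    simp only [smul_eq_mul]
    module
  have h3 := hc.le_slope_of_hasDerivAt (Set.mem_univ 0) (Set.mem_univ 1) zero_lt_one h2
  simp [slope] at h3
  linarith

theorem gd_interp {H : Type*} [NormedAddCommGroup H] [InnerProductSpace ℝ H] [CompleteSpace H]
    (f : H → ℝ) (f' : H → H) (L : ℝ) (hL : 0 < L)
    (hconv : ConvexOn ℝ Set.univ f)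
    (hgrad : ∀ x, HasGradientAt f (f' x) x)
    (hlip : LipschitzWith L.toNNReal f') (x y : H) :
    inner ℝ (f' y) (L • (x - y)) + 1 / 2 * ‖f' x - f' y‖ ^ 2 ≤ L * f x - L * f y := by
  have h1 := gd_descent f f' L hL hgrad hlip x (-(1 / L) • (f' x - f' y))
  have h2 := gd_convex f f' hconv hgrad y (x - y + (-(1 / L) • (f' x - f' y)))
  have h3 : y + (x - y + (-(1 / L) • (f' x - f' y))) = x + (-(1 / L) • (f' x - f' y)) := by abel
  rw [h3, inner_add_right, inner_smul_right] at h2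
  rw [inner_smul_right, norm_smul, mul_pow, Real.norm_eq_abs, sq_abs] at h1
  have h4 : inner ℝ (f' x) (f' x - f' y) - inner ℝ (f' y) (f' x - f' y)
      = ‖f' x - f' y‖ ^ 2 := by
    rw [← inner_sub_left, real_inner_self_eq_norm_sq]
  rw [inner_smul_right]
  set n := ‖f' x - f' y‖ ^ 2
  set p := inner ℝ (f' x) (f' x - f' y)
  set q := inner ℝ (f' y) (f' x - f' y)
  have h5 := h2.trans h1
  have h6 := mul_le_mul_of_nonneg_left h5 hL.le
  have e1 : L * (f y + (inner ℝ (f' y) (x - y) + -(1 / L) * q))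
      = L * f y + L * inner ℝ (f' y) (x - y) - q := by field_simp; ring
  have e2 : L * (f x + -(1 / L) * p + L / 2 * ((-(1 / L)) ^ 2 * n))
      = L * f x - p + n / 2 := by field_simp; ring
  rw [e1, e2] at h6
  linarith

/-- Multiplier sequence. -/
noncomputable def gdSig (r : ℝ) : ℕ → ℝ
  | 0 => 0
  | n + 1 => (gdSig r n + ((n : ℝ) + 1) * r - n - 1 / 2) / r ^ 2

theorem gdSig_succ (r : ℝ) (hr : 0 < r) (n : ℕ) :
    r ^ 2 * gdSig r (n + 1) = gdSig r n + ((n : ℝ) + 1) * r - n - 1 / 2 := by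
  rw [gdSig]; field_simp

theorem gdSig_le (r : ℝ) (hr : 0 < r) (n : ℕ) : gdSig r n ≤ n / 2 := by
  induction n with
  | zero => simp [gdSig]
  | succ n ih =>
    have h1 := gdSig_succ r hr n
    have hr2 : 0 < r ^ 2 := by positivity
    have hn : (0 : ℝ) ≤ n := n.cast_nonneg
    push_cast
    refine le_of_mul_le_mul_left ?_ hr2
    rw [h1]
    nlinarith [mul_nonneg (by linarith : (0 : ℝ) ≤ n + 1) (sq_nonneg (r - 1))]

theorem gdSig_closed (r : ℝ) (hr : 0 < r) (n : ℕ) :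
    2 * (1 + r) ^ 2 * r ^ (2 * n) * gdSig r n = r ^ (2 * n) * (1 + 2 * n * (1 + r)) - 1 := by
  induction n with
  | zero => simp [gdSig]
  | succ n ih =>
    have h1 := gdSig_succ r hr n
    have e : r ^ (2 * (n + 1)) = r ^ (2 * n) * r ^ 2 := by ring
    rw [e]
    push_cast
    linear_combination ih + 2 * (1 + r) ^ 2 * r ^ (2 * n) * h1

/-- Linear regime, one step. `A i j` is the Gram matrix. -/
theorem gd_lin_step (r n F0 F F' a b c : ℝ) (hr : r ≤ 1) (hn : 0 ≤ n)
    (hcond : (n + 1) * r ≤ n + 1 / 2)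
    (hpos : 0 ≤ a - 2 * b + c)
    (q1 : (1 + r) * b + 1 / 2 * (a - 2 * b + c) ≤ F - F')
    (q2 : -(1 + r) * a + 1 / 2 * (a - 2 * b + c) ≤ F' - F)
    (ih : n * (1 + r) * a ≤ F0 - F) : (n + 1) * (1 + r) * c ≤ F0 - F' := by
  have h1 : 0 ≤ n * ((1 + r) * a - (1 + r) * b - (a - 2 * b + c)) :=
    mul_nonneg hn (by linarith)
  nlinarith [mul_nonneg (by linarith : 0 ≤ n + 1 / 2 - (n + 1) * r) hpos]

/-- Mixed regime, one step (three consecutive iterates). -/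
theorem gd_mix_step (r n s0 s s' F0 Fa Fb Fc aa ab ac bb bc cc : ℝ)
    (hr0 : 0 < r) (hr : r ≤ 1) (hn : 1 ≤ n) (hs0 : s0 ≤ (n - 1) / 2) (hs : 0 ≤ s) (hsn : s ≤ n / 2)
    (hs' : r ^ 2 * s' = s + (n + 1) * r - n - 1 / 2)
    (q1 : (1 + r) * ab + 1 / 2 * (aa - 2 * ab + bb) ≤ Fa - Fb)
    (q2 : -(1 + r) * aa + 1 / 2 * (aa - 2 * ab + bb) ≤ Fb - Fa)
    (q3 : (1 + r) * (ac + bc) + 1 / 2 * (aa - 2 * ac + cc) ≤ Fa - Fc)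
    (q4 : -(1 + r) * (aa + ab) + 1 / 2 * (aa - 2 * ac + cc) ≤ Fc - Fa)
    (ih : n * (1 + r) * bb - r ^ 2 * s * (aa - 2 * ab + bb)
      + (2 * n - 1 - (1 + r) * s0) * (Fb - Fa + (1 + r) * aa - 1 / 2 * (aa - 2 * ab + bb))
      + (2 * n - 2 * s0) * (Fa - Fb - (1 + r) * ab - 1 / 2 * (aa - 2 * ab + bb)) ≤ F0 - Fb) :
    (n + 1) * (1 + r) * cc - r ^ 2 * s' * (bb - 2 * bc + cc)
      + (2 * (n + 1) - 1 - (1 + r) * s) * (Fc - Fb + (1 + r) * bb - 1 / 2 * (bb - 2 * bc + cc))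
      + (2 * (n + 1) - 2 * s) * (Fb - Fc - (1 + r) * bc - 1 / 2 * (bb - 2 * bc + cc)) ≤ F0 - Fc := by
  have c1 : 0 ≤ 2 * n - 1 - (1 + r) * s0 - 2 * r * s := by nlinarith
  have c2 : 0 ≤ 2 * n - 2 * s0 - (1 + r) * s := by nlinarith
  have k1 := mul_nonneg c1 (sub_nonneg.2 q2)
  have k2 := mul_nonneg c2 (sub_nonneg.2 q1)
  have k3 := mul_nonneg hs (sub_nonneg.2 q3)
  have k4 := mul_nonneg (mul_nonneg hr0.le hs) (sub_nonneg.2 q4)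
  rw [hs']
  nlinarith

theorem gd_scalar (r : ℝ) (hr0 : -1 ≤ r) (hr : r ≤ 1) (F : ℕ → ℝ) (A : ℕ → ℕ → ℝ) (N : ℕ)
    (hN : 1 ≤ N)
    (hA : ∀ i j (a b : ℝ), 0 ≤ a ^ 2 * A i i + 2 * a * b * A i j + b ^ 2 * A j j)
    (q1 : ∀ k, k < N → (1 + r) * A k (k+1)
      + 1 / 2 * (A k k - 2 * A k (k+1) + A (k+1) (k+1)) ≤ F k - F (k+1))
    (q2 : ∀ k, k < N → -(1 + r) * A k k
      + 1 / 2 * (A k k - 2 * A k (k+1) + A (k+1) (k+1)) ≤ F (k+1) - F k)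
    (q3 : ∀ k, k + 1 < N → (1 + r) * (A k (k+2) + A (k+1) (k+2))
      + 1 / 2 * (A k k - 2 * A k (k+2) + A (k+2) (k+2)) ≤ F k - F (k+2))
    (q4 : ∀ k, k + 1 < N → -(1 + r) * (A k k + A k (k+1))
      + 1 / 2 * (A k k - 2 * A k (k+2) + A (k+2) (k+2)) ≤ F (k+2) - F k) :
    (N * (1 + r) * A N N ≤ F 0 - F N) ∨
    (A N N ≤ r ^ (2 * N) * (2 * (F 0 - F N) + A N N)) := by
  have hd : ∀ i j, 0 ≤ A i i - 2 * A i j + A j j := fun i j => by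
    have := hA i j 1 (-1); linarith
  rcases le_or_gt r (1 / 2) with hr2 | hr2
  · left
    have key : ∀ n : ℕ, n ≤ N → n * (1 + r) * A n n ≤ F 0 - F n := by
      intro n
      induction n with
      | zero => simp
      | succ n ih =>
        intro hn
        have hn0 : (0 : ℝ) ≤ n := n.cast_nonneg
        have := gd_lin_step r n (F 0) (F n) (F (n+1)) _ _ _ hr hn0 (by nlinarith) (hd n (n+1))
          (q1 n hn) (q2 n hn) (ih (by omega))
        push_cast
        exact this
    exact key N le_rfl
  have hrp : 0 < r := by linarith
  have key : ∀ n : ℕ, n + 1 ≤ N →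
      ((0 ≤ gdSig r (n+1) ∧
        ((n : ℝ) + 1) * (1 + r) * A (n+1) (n+1)
          - r ^ 2 * gdSig r (n+1) * (A n n - 2 * A n (n+1) + A (n+1) (n+1))
        + (2 * ((n : ℝ) + 1) - 1 - (1 + r) * gdSig r n) * (F (n+1) - F n + (1 + r) * A n n
            - 1 / 2 * (A n n - 2 * A n (n+1) + A (n+1) (n+1)))
        + (2 * ((n : ℝ) + 1) - 2 * gdSig r n) * (F n - F (n+1) - (1 + r) * A n (n+1)
            - 1 / 2 * (A n n - 2 * A n (n+1) + A (n+1) (n+1))) ≤ F 0 - F (n+1)) ∨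
       (((n : ℝ) + 1 + 1) * r ≤ (n : ℝ) + 1 + 1 / 2 ∧
        ((n : ℝ) + 1) * (1 + r) * A (n+1) (n+1) ≤ F 0 - F (n+1))) := by
    intro n
    induction n with
    | zero =>
      intro _
      left
      have h1 := gdSig_succ r hrp 0
      simp only [gdSig, Nat.cast_zero] at h1 ⊢
      refine ⟨div_nonneg (by linarith) (by positivity), ?_⟩
      rw [h1]
      apply le_of_eq
      norm_num
      ring
    | succ n ih =>
      intro hn
      have hn0 : (0 : ℝ) ≤ n := n.cast_nonneg
      push_cast
      rcases ih (by omega) with ⟨hs, ih⟩ | ⟨hc, ih⟩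
      · have hrec := gdSig_succ r hrp (n+1)
        push_cast at hrec
        have hle0 := gdSig_le r hrp n
        have hle1 := gdSig_le r hrp (n+1)
        push_cast at hle1
        have := gd_mix_step r ((n : ℝ) + 1) (gdSig r n) (gdSig r (n+1)) (gdSig r (n+1+1)) (F 0)
          (F n) (F (n+1)) (F (n+1+1)) (A n n) (A n (n+1)) (A n (n+1+1)) (A (n+1) (n+1))
          (A (n+1) (n+1+1)) (A (n+1+1) (n+1+1)) hrp hr (by linarith) (by linarith) hs hle1 hrec
          (q1 n (by omega)) (q2 n (by omega)) (q3 n (by omega)) (q4 n (by omega)) ih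
        rcases le_or_gt 0 (gdSig r (n+1+1)) with h0 | h0
        · exact Or.inl ⟨h0, this⟩
        · right
          have hneg : r ^ 2 * gdSig r (n+1+1) ≤ 0 :=
            mul_nonpos_of_nonneg_of_nonpos (by positivity) h0.le
          refine ⟨by linarith, ?_⟩
          have hsr : 0 ≤ (1 - r) * gdSig r (n+1) := mul_nonneg (by linarith) hs
          have c1 : 0 ≤ 2 * ((n : ℝ) + 1 + 1) - 1 - (1 + r) * gdSig r (n+1) := by linarith
          have c2 : 0 ≤ 2 * ((n : ℝ) + 1 + 1) - 2 * gdSig r (n+1) := by linarith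
          have k1 := mul_nonneg c1 (sub_nonneg.2 (q2 (n+1) (by omega)))
          have k2 := mul_nonneg c2 (sub_nonneg.2 (q1 (n+1) (by omega)))
          have k3 := mul_nonpos_of_nonpos_of_nonneg hneg (hd (n+1) (n+1+1))
          linarith
      · right
        refine ⟨by linarith, ?_⟩
        exact gd_lin_step r ((n : ℝ) + 1) (F 0) (F (n+1)) (F (n+1+1)) _ _ _ hr (by linarith) hc
          (hd (n+1) (n+1+1)) (q1 (n+1) (by omega)) (q2 (n+1) (by omega)) ih
  obtain ⟨n, rfl⟩ : ∃ n, N = n + 1 := ⟨N - 1, by omega⟩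
  rcases key n le_rfl with ⟨hs, hI⟩ | ⟨_, hI⟩
  · right
    have hn0 : (0 : ℝ) ≤ n := n.cast_nonneg
    have hle0 := gdSig_le r hrp n
    have hle1 := gdSig_le r hrp (n+1)
    have hcl := gdSig_closed r hrp (n+1)
    push_cast at hle1 hcl
    have c1 : 0 ≤ 2 * ((n : ℝ) + 1) - 1 - (1 + r) * gdSig r n - 2 * r * gdSig r (n+1) := by
      nlinarith
    have c2 : 0 ≤ 2 * ((n : ℝ) + 1) - 2 * gdSig r n - 2 * r * gdSig r (n+1) := by nlinarith
    have k1 := mul_nonneg c1 (sub_nonneg.2 (q2 n (by omega)))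
    have k2 := mul_nonneg c2 (sub_nonneg.2 (q1 n (by omega)))
    have k3 := mul_nonneg hs (hA n (n+1) r 1)
    have main : (((n : ℝ) + 1) * (1 + r) - gdSig r (n+1) * (1 + r) ^ 2) * A (n+1) (n+1)
        ≤ F 0 - F (n+1) := by linarith
    have hp : 0 < r ^ (2 * (n+1)) := by positivity
    have := mul_le_mul_of_nonneg_left main hp.le
    have e : A (n+1) (n+1) * (2 * (1 + r) ^ 2 * r ^ (2 * (n+1)) * gdSig r (n+1))
      = A (n+1) (n+1) * (r ^ (2 * (n+1)) * (1 + 2 * ((n : ℝ) + 1) * (1 + r)) - 1) := by rw [hcl]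
    linarith
  · left
    push_cast
    exact hI

/-- `N` steps of exact gradient descent on a convex `L`-smooth function
attaining its minimum at `xstar`, with constant normalized stepsize `h ∈ [0, 2]`:
`(1/L)·‖∇f(x_N)‖² ≤ max { 1/(N·h + 1/2) , 2(1-h)^{2N} } · (f(x0) - f(x*))`. -/
theorem N_steps_exact_gd
    {H : Type*} [NormedAddCommGroup H] [InnerProductSpace ℝ H] [CompleteSpace H]
    (f : H → ℝ) (f' : H → H) (L : ℝ) (hL : 0 < L)
    (hconv : ConvexOn ℝ Set.univ f)
    (hgrad : ∀ x, HasGradientAt f (f' x) x)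
    (hlip : LipschitzWith L.toNNReal f')
    (xstar : H) (hmin : ∀ y, f xstar ≤ f y)
    (h : ℝ) (hh : h ∈ Set.Icc (0 : ℝ) 2)
    (N : ℕ) (hN : 1 ≤ N)
    (x : ℕ → H) (hstep : ∀ k < N, x (k + 1) = x k - (h / L) • f' (x k)) :
    (1 / L) * ‖f' (x N)‖ ^ 2 ≤
      max (1 / ((N : ℝ) * h + 1 / 2)) (2 * (1 - h) ^ (2 * N)) * (f (x 0) - f xstar) := by

  obtain ⟨hh0, hh2⟩ := hh
  have hint := gd_interp f f' L hL hconv hgrad hlip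
  have hs : ∀ k, k < N → L • (x k - x (k+1)) = h • f' (x k) := by
    intro k hk
    rw [hstep k hk, sub_sub_cancel, smul_smul, mul_div_cancel₀ _ hL.ne']
  have hs' : ∀ k, k < N → L • (x (k+1) - x k) = -(h • f' (x k)) := by
    intro k hk
    rw [← hs k hk, ← smul_neg, neg_sub]
  have hs2 : ∀ k, k + 1 < N → L • (x k - x (k+2)) = h • f' (x k) + h • f' (x (k+1)) := by
    intro k hk
    rw [← hs k (by omega), ← hs (k+1) hk, ← smul_add, sub_add_sub_cancel]
  have hs2' : ∀ k, k + 1 < N → L • (x (k+2) - x k) = -(h • f' (x k) + h • f' (x (k+1))) := by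
    intro k hk
    rw [← hs2 k hk, ← smul_neg, neg_sub]
  have hmain := gd_scalar (h - 1) (by linarith) (by linarith) (fun k => L * f (x k))
    (fun i j => inner ℝ (f' (x i)) (f' (x j))) N hN
    (by
      intro i j a b
      have h0 : 0 ≤ ‖a • f' (x i) + b • f' (x j)‖ ^ 2 := by positivity
      rw [norm_add_sq_real, ← real_inner_self_eq_norm_sq, ← real_inner_self_eq_norm_sq] at h0
      simp only [inner_smul_left, inner_smul_right, conj_trivial] at h0
      linarith)
    (by
      intro k hk
      have h0 := hint (x k) (x (k+1))
      rw [hs k hk, norm_sub_sq_real, ← real_inner_self_eq_norm_sq, ← real_inner_self_eq_norm_sq,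
        inner_smul_right, real_inner_comm (f' (x k)) (f' (x (k+1)))] at h0
      have := real_inner_comm (f' (x k)) (f' (x (k+1)))
      linarith)
    (by
      intro k hk
      have h0 := hint (x (k+1)) (x k)
      rw [hs' k hk, norm_sub_sq_real, ← real_inner_self_eq_norm_sq, ← real_inner_self_eq_norm_sq,
        inner_neg_right, inner_smul_right, real_inner_comm (f' (x k)) (f' (x (k+1)))] at h0
      have := real_inner_comm (f' (x k)) (f' (x (k+1)))
      linarith)
    (by
      intro k hk
      have h0 := hint (x k) (x (k+2))
      rw [hs2 k hk, norm_sub_sq_real, ← real_inner_self_eq_norm_sq, ← real_inner_self_eq_norm_sq,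
        inner_add_right, inner_smul_right, inner_smul_right] at h0
      have e1 := real_inner_comm (f' (x k)) (f' (x (k+2)))
      have e2 := real_inner_comm (f' (x (k+1))) (f' (x (k+2)))
      rw [e1, e2] at h0
      linarith)
    (by
      intro k hk
      have h0 := hint (x (k+2)) (x k)
      rw [hs2' k hk, norm_sub_sq_real, ← real_inner_self_eq_norm_sq, ← real_inner_self_eq_norm_sq,
        inner_neg_right, inner_add_right, inner_smul_right, inner_smul_right] at h0
      have e1 := real_inner_comm (f' (x k)) (f' (x (k+2)))
      linarith)
  simp only [real_inner_self_eq_norm_sq] at hmain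
  have hlast : ‖f' (x N)‖ ^ 2 ≤ 2 * (L * f (x N) - L * f xstar) := by
    have h1 := gd_descent f f' L hL hgrad hlip (x N) (-(1 / L) • f' (x N))
    have h2 := (hmin _).trans h1
    rw [inner_smul_right, norm_smul, mul_pow, Real.norm_eq_abs, sq_abs,
      real_inner_self_eq_norm_sq] at h2
    have h3 := mul_le_mul_of_nonneg_left h2 hL.le
    have e2 : L * (f (x N) + -(1 / L) * ‖f' (x N)‖ ^ 2 + L / 2 * ((-(1 / L)) ^ 2 * ‖f' (x N)‖ ^ 2))
      = L * f (x N) - ‖f' (x N)‖ ^ 2 / 2 := by field_simp; ring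
    rw [e2] at h3
    linarith
  have hD : 0 ≤ f (x 0) - f xstar := sub_nonneg.2 (hmin _)
  have hNh : 0 < (N : ℝ) * h + 1 / 2 := by positivity
  set G := ‖f' (x N)‖ ^ 2
  rcases hmain with hm | hm
  · refine le_trans ?_ (mul_le_mul_of_nonneg_right (le_max_left _ _) hD)
    rw [one_div_mul_eq_div, one_div_mul_eq_div, div_le_div_iff₀ hL hNh]
    linarith
  · refine le_trans ?_ (mul_le_mul_of_nonneg_right (le_max_right _ _) hD)
    have e : (1 - h) ^ (2 * N) = (h - 1) ^ (2 * N) := by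
      rw [pow_mul, pow_mul]; congr 1; ring
    rw [e, one_div_mul_eq_div, div_le_iff₀ hL]
    have hp : 0 ≤ (h - 1) ^ (2 * N) := by rw [pow_mul]; positivity
    have := mul_le_mul_of_nonneg_left hlast hp
    linarith
end
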